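/- arXiv:2309.01138 — 2 statements merged into one kernel-verified Lean document; each statement's English description precedes it below -/
import Mathlib

section
/- Let f : ℝ → ℝ be convex and differentiable, and let L ∈ ℝ. Then f'(t) tends to L as t → +∞ if and only if f(t)/t tends to L as t → +∞. -/
open Filter Topology

/-- The graph of a differentiable convex function lies above each of its tangent lines. -/
theorem ConvexOn.add_deriv_mul_sub_le {f : ℝ → ℝ} {S : Set ℝ} (hf : ConvexOn ℝ S f) {s t : ℝ}
    (hs : s ∈ S) (ht : t ∈ S) (hd : DifferentiableAt ℝ f s) :
    f s + deriv f s * (t - s) ≤ f t := by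
  rcases lt_trichotomy s t with h | rfl | h
  · have := hf.deriv_le_slope hs ht h hd
    rw [slope_def_field, le_div_iff₀ (sub_pos.2 h)] at this
    linarith
  · simp
  · have := hf.slope_le_deriv ht hs h hd
    rw [slope_def_field, div_le_iff₀ (sub_pos.2 h)] at this
    linarith

theorem tendsto_add_const_div_atTop (a c : ℝ) :
    Tendsto (fun t : ℝ => a + c / t) atTop (𝓝 a) := by
  simpa using (tendsto_const_nhds (x := a)).add (tendsto_const_nhds.div_atTop tendsto_id)

/-- For a convex differentiable function `f : ℝ → ℝ`, the derivative `f'(t)` tends to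
`L` as `t → +∞` if and only if `f(t)/t` tends to `L` as `t → +∞`. -/
theorem convex_deriv_tendsto_iff_div_tendsto
    (f : ℝ → ℝ) (hconv : ConvexOn ℝ Set.univ f) (hdiff : Differentiable ℝ f) (L : ℝ) :
    Filter.Tendsto (deriv f) Filter.atTop (nhds L) ↔
      Filter.Tendsto (fun t : ℝ => f t / t) Filter.atTop (nhds L) := by
  have tangent (s t : ℝ) : f s + deriv f s * (t - s) ≤ f t :=
    hconv.add_deriv_mul_sub_le (Set.mem_univ s) (Set.mem_univ t) (hdiff s)
  have lower (s : ℝ) : ∀ᶠ t in atTop, deriv f s + (f s - s * deriv f s) / t ≤ f t / t := by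
    filter_upwards [eventually_gt_atTop 0] with t ht
    have := tangent s t
    rw [le_div_iff₀ ht, add_mul, div_mul_cancel₀ _ ht.ne']
    linarith
  have upper : ∀ᶠ t in atTop, f t / t ≤ deriv f t + f 0 / t := by
    filter_upwards [eventually_gt_atTop 0] with t ht
    have := tangent t 0
    rw [div_le_iff₀ ht, add_mul, div_mul_cancel₀ _ ht.ne']
    linarith
  have hzero : Tendsto (fun t : ℝ => f 0 / t) atTop (𝓝 0) :=
    tendsto_const_nhds.div_atTop tendsto_id
  constructor
  · intro h
    refine tendsto_order.2 ⟨fun a ha => ?_, fun b hb => ?_⟩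
    · obtain ⟨s, hs⟩ := (h.eventually_const_lt ha).exists
      filter_upwards [lower s, (tendsto_add_const_div_atTop _ _).eventually_const_lt hs]
        with t h₁ h₂ using h₂.trans_le h₁
    · have hlim : Tendsto (fun t => deriv f t + f 0 / t) atTop (𝓝 L) := by
        simpa using h.add hzero
      filter_upwards [upper, hlim.eventually_lt_const hb] with t h₁ h₂ using h₁.trans_lt h₂
  · intro h
    have hle (s : ℝ) : deriv f s ≤ L :=
      le_of_tendsto_of_tendsto (tendsto_add_const_div_atTop _ _) h (lower s)
    have hlim : Tendsto (fun t => f t / t - f 0 / t) atTop (𝓝 L) := by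
      simpa using h.sub hzero
    refine tendsto_of_tendsto_of_tendsto_of_le_of_le' hlim tendsto_const_nhds ?_
      (Eventually.of_forall hle)
    filter_upwards [upper] with t ht using sub_le_iff_le_add.2 ht
end

section
/- Let E be a finite-dimensional real normed vector space and let f : E → ℝ be continuous and convex along every line through the origin, i.e. for every β ∈ E the function t ↦ f(tβ) is convex on ℝ. Then the following are equivalent: (i) there exist constants C₁ > 0 and C₂ ∈ ℝ such that ‖v‖ ≤ C₁·f(v) + C₂ for all v ∈ E; (ii) for every β ∈ E with ‖β‖ = 1 there exist ε > 0 and T ≥ 0 such that f(tβ) ≥ ε·t for all t ≥ T. -/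
/-- If a convex function on `ℝ` rises by at least `1` from `0` to `s > 0`, then it grows beyond
`s` at least as fast as the line of slope `s⁻¹` through its value at `0`. -/
lemma ConvexOn.add_div_le_of_add_one_le {g : ℝ → ℝ} (hg : ConvexOn ℝ Set.univ g) {s t : ℝ}
    (hs : 0 < s) (hst : s ≤ t) (h : g 0 + 1 ≤ g s) : g 0 + t / s ≤ g t := by
  have ht : 0 < t := hs.trans_le hst
  have hle : s / t ≤ 1 := (div_le_one ht).2 hst
  have key := hg.2 (Set.mem_univ t) (Set.mem_univ 0) (div_pos hs ht).le
    (sub_nonneg.2 hle) (by ring)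
  simp only [smul_eq_mul, mul_zero, add_zero, div_mul_cancel₀ s ht.ne'] at key
  have hone : 1 ≤ s / t * (g t - g 0) := by linarith
  rw [div_mul_eq_mul_div, le_div_iff₀ ht, one_mul] at hone
  have := (div_le_iff₀' hs).2 hone
  linarith

/-- On a compact set of directions, pointwise positive slopes at infinity give a uniform positive
slope at infinity. -/
lemma IsCompact.exists_uniform_slope {E : Type*} [NormedAddCommGroup E] [NormedSpace ℝ E]
    {f : E → ℝ} (hcont : Continuous f)
    (hconv : ∀ β : E, ConvexOn ℝ Set.univ fun t : ℝ => f (t • β)) {K : Set E}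
    (hK : IsCompact K) (h : ∀ β ∈ K, ∃ s : ℝ, 0 < s ∧ f 0 + 1 < f (s • β)) :
    ∃ S : ℝ, 0 < S ∧ ∀ β ∈ K, ∀ t : ℝ, S ≤ t → f 0 + t / S ≤ f (t • β) := by
  refine hK.induction_on
    (p := fun A => ∃ S : ℝ, 0 < S ∧ ∀ β ∈ A, ∀ t : ℝ, S ≤ t → f 0 + t / S ≤ f (t • β))
    ⟨1, one_pos, by simp⟩ ?_ ?_ ?_
  · rintro A B hAB ⟨S, hS, hB⟩
    exact ⟨S, hS, fun β hβ => hB β (hAB hβ)⟩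
  · rintro A B ⟨S, hS, hA⟩ ⟨R, hR, hB⟩
    refine ⟨max S R, lt_max_of_lt_left hS, fun β hβ t ht => ?_⟩
    have hSt : S ≤ t := (le_max_left S R).trans ht
    have hRt : R ≤ t := (le_max_right S R).trans ht
    have ht0 : 0 ≤ t := hS.le.trans hSt
    rcases hβ with hβ | hβ
    · have := div_le_div_of_nonneg_left ht0 hS (le_max_left S R)
      linarith [hA β hβ t hSt]
    · have := div_le_div_of_nonneg_left ht0 hR (le_max_right S R)
      linarith [hB β hβ t hRt]
  · intro β hβ
    obtain ⟨s, hs, hlt⟩ := h β hβ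
    have hopen : IsOpen {x : E | f 0 + 1 < f (s • x)} :=
      isOpen_lt continuous_const (hcont.comp (continuous_const_smul s))
    refine ⟨_, mem_nhdsWithin_of_mem_nhds (hopen.mem_nhds hlt), s, hs, fun x hx t hst => ?_⟩
    have hx' : f 0 + 1 < f (s • x) := hx
    simpa using (hconv x).add_div_le_of_add_one_le hs hst (by simpa using hx'.le)


/-- For a continuous function on a finite-dimensional normed space that is convex along
every line through the origin, linear properness is equivalent to strict positivity of
the asymptotic slope in every unit direction. -/
theorem linearly_proper_iff_positive_maximal_weights
    {E : Type*} [NormedAddCommGroup E] [NormedSpace ℝ E] [FiniteDimensional ℝ E]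
    (f : E → ℝ) (hcont : Continuous f)
    (hconv : ∀ β : E, ConvexOn ℝ Set.univ fun t : ℝ => f (t • β)) :
    (∃ C₁ : ℝ, 0 < C₁ ∧ ∃ C₂ : ℝ, ∀ v : E, ‖v‖ ≤ C₁ * f v + C₂) ↔
      (∀ β : E, ‖β‖ = 1 → ∃ ε : ℝ, 0 < ε ∧ ∃ T : ℝ, 0 ≤ T ∧
        ∀ t : ℝ, T ≤ t → ε * t ≤ f (t • β)) := by
  constructor
  · rintro ⟨C₁, hC₁, C₂, h⟩ β hβ
    refine ⟨(2 * C₁)⁻¹, by positivity, 2 * |C₂|, by positivity, fun t ht => ?_⟩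
    have ht0 : 0 ≤ t := le_trans (by positivity) ht
    have hv := h (t • β)
    rw [norm_smul, hβ, mul_one, Real.norm_of_nonneg ht0] at hv
    rw [inv_mul_le_iff₀ (by positivity)]
    linarith [le_abs_self C₂]
  · intro h
    obtain ⟨S, hS, hgrow⟩ := (isCompact_sphere (0 : E) 1).exists_uniform_slope hcont hconv
      fun β hβ => by
        obtain ⟨ε, hε, T, hT, hf⟩ := h β (by simpa using hβ)
        obtain ⟨s, hs⟩ := exists_gt (max T ((f 0 + 1) / ε))
        have hTs : T < s := (le_max_left _ _).trans_lt hs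
        have hfs : (f 0 + 1) / ε < s := (le_max_right _ _).trans_lt hs
        exact ⟨s, hT.trans_lt hTs, ((div_lt_iff₀' hε).1 hfs).trans_le (hf s hTs.le)⟩
    obtain ⟨m, hm⟩ := (isCompact_closedBall (0 : E) S).bddBelow_image hcont.continuousOn
    refine ⟨S, hS, max (-(S * f 0)) (S - S * m), fun v => ?_⟩
    rcases le_total ‖v‖ S with hv | hv
    · have hmv : m ≤ f v := hm (Set.mem_image_of_mem f (by simpa using hv))
      have := mul_le_mul_of_nonneg_left hmv hS.le
      linarith [le_max_right (-(S * f 0)) (S - S * m)]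
    · have hv0 : ‖v‖ ≠ 0 := (hS.trans_le hv).ne'
      have hfv := hgrow (‖v‖⁻¹ • v) (by simp [norm_smul, hv0]) ‖v‖ hv
      rw [smul_inv_smul₀ hv0] at hfv
      have hdiv : ‖v‖ / S ≤ f v - f 0 := by linarith
      rw [div_le_iff₀' hS] at hdiv
      linarith [le_max_left (-(S * f 0)) (S - S * m)]
end
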